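/- Let F be a finite field with q elements, let n ≥ 2 and k ≥ 1 be integers with 2k ≤ n, and let m be a natural number with q^m > C(n,2k) · q^{2k}. Then there exist a matrix Π ∈ F^{m×n} and a function R : F^m → F^n such that for every vector w ∈ F^n with at most k nonzero entries, R(Πw) = w. -/

import Mathlib

open scoped Classical

theorem card_filter_mulVec_eq_zero_mul {F : Type*} [Field F] [Fintype F] {n m : ℕ}
    {v : Fin n → F} (hv : v ≠ 0) :
    (Finset.univ.filter fun A : Matrix (Fin m) (Fin n) F => A.mulVec v = 0).card *
      Fintype.card F ^ m = Fintype.card (Matrix (Fin m) (Fin n) F) := by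
  let f : Matrix (Fin m) (Fin n) F →+ (Fin m → F) :=
    AddMonoidHom.mk' (fun A => A.mulVec v) fun A B => Matrix.add_mulVec A B v
  have hf : Function.Surjective f := by
    intro y
    obtain ⟨i, hi⟩ := Function.ne_iff.mp hv
    refine ⟨Matrix.vecMulVec y (Pi.single i (v i)⁻¹), ?_⟩
    change (Matrix.vecMulVec y (Pi.single i (v i)⁻¹)).mulVec v = y
    have hi' : v i ≠ 0 := hi
    simp [Matrix.vecMulVec_mulVec, hi']
  have h := f.ker.card_mul_index
  rw [AddSubgroup.index_ker, AddMonoidHom.range_eq_top.mpr hf, AddSubgroup.card_top,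
    Nat.card_eq_fintype_card, Nat.card_eq_fintype_card, Nat.card_eq_fintype_card,
    Fintype.card_fun, Fintype.card_fin] at h
  rw [← h]
  congr 1
  rw [← Fintype.card_subtype]
  exact Fintype.card_congr (Equiv.refl _)

theorem card_filter_support_subset {F : Type*} [Field F] [Fintype F] {n : ℕ}
    (T : Finset (Fin n)) :
    (Finset.univ.filter fun v : Fin n → F => ∀ i, v i ≠ 0 → i ∈ T).card =
      Fintype.card F ^ T.card := by
  have h : (Finset.univ.filter fun v : Fin n → F => ∀ i, v i ≠ 0 → i ∈ T) =
      Fintype.piFinset fun i => if i ∈ T then Finset.univ else {0} := by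
    ext v
    simp only [Finset.mem_filter, Finset.mem_univ, true_and, Fintype.mem_piFinset]
    refine forall_congr' fun i => ?_
    by_cases hi : i ∈ T <;> simp [hi]
  rw [h, Fintype.card_piFinset]
  simp [apply_ite Finset.card]

theorem card_filter_hammingNorm_le {F : Type*} [Field F] [Fintype F] {n d : ℕ} (hd : d ≤ n) :
    (Finset.univ.filter fun v : Fin n → F => hammingNorm v ≤ d).card ≤
      n.choose d * Fintype.card F ^ d := by
  have hsub : (Finset.univ.filter fun v : Fin n → F => hammingNorm v ≤ d) ⊆
      (Finset.powersetCard d (Finset.univ : Finset (Fin n))).biUnion fun T =>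
        Finset.univ.filter fun v : Fin n → F => ∀ i, v i ≠ 0 → i ∈ T := by
    intro v hv
    simp only [Finset.mem_filter, Finset.mem_univ, true_and] at hv
    obtain ⟨T, hT, hTd⟩ := Finset.exists_superset_card_eq
      (s := Finset.univ.filter fun i => v i ≠ 0) (n := d)
      (by unfold hammingNorm at hv; convert hv) (by simpa using hd)
    simp only [Finset.mem_biUnion, Finset.mem_powersetCard, Finset.mem_filter]
    exact ⟨T, ⟨Finset.subset_univ _, hTd⟩, Finset.mem_univ _, fun i hi => hT (by simpa using hi)⟩
  refine (Finset.card_le_card hsub).trans ((Finset.card_biUnion_le_card_mul _ _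
    (Fintype.card F ^ d) fun T hT => ?_).trans ?_)
  · rw [card_filter_support_subset, (Finset.mem_powersetCard.mp hT).2]
  · simp

theorem exists_matrix_mulVec_ne_zero {F : Type*} [Field F] [Fintype F] {n m d : ℕ} (hd : d ≤ n)
    (h : n.choose d * Fintype.card F ^ d < Fintype.card F ^ m) :
    ∃ A : Matrix (Fin m) (Fin n) F,
      ∀ v : Fin n → F, hammingNorm v ≤ d → A.mulVec v = 0 → v = 0 := by
  by_contra! hbad
  set S := Finset.univ.filter fun v : Fin n → F => hammingNorm v ≤ d with hS
  have hcover : (Finset.univ : Finset (Matrix (Fin m) (Fin n) F)) ⊆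
      (S.filter (· ≠ 0)).biUnion fun v => Finset.univ.filter fun A => A.mulVec v = 0 := by
    intro A _
    obtain ⟨v, hvd, hAv, hv⟩ := hbad A
    simp only [Finset.mem_biUnion, Finset.mem_filter]
    exact ⟨v, ⟨by simpa [hS] using hvd, hv⟩, Finset.mem_univ _, hAv⟩
  have hle := Nat.mul_le_mul_right (Fintype.card F ^ m)
    ((Finset.card_le_card hcover).trans Finset.card_biUnion_le)
  rw [Finset.sum_mul, Finset.sum_congr rfl fun v hv =>
    card_filter_mulVec_eq_zero_mul (Finset.mem_filter.mp hv).2, Finset.sum_const, smul_eq_mul,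
    Finset.card_univ, mul_comm] at hle
  have hcard : 0 < Fintype.card (Matrix (Fin m) (Fin n) F) := Fintype.card_pos
  have hlt : (S.filter (· ≠ 0)).card < Fintype.card F ^ m :=
    ((Finset.card_filter_le _ _).trans (card_filter_hammingNorm_le hd)).trans_lt h
  exact absurd (Nat.le_of_mul_le_mul_right hle hcard) hlt.not_ge

theorem stmt13 (F : Type*) [Field F] [Fintype F] (q : ℕ) (hq : Fintype.card F = q)
    (n k m : ℕ) (hn : 2 ≤ n) (hk : 1 ≤ k) (hkn : 2 * k ≤ n)
    (hm : n.choose (2 * k) * q ^ (2 * k) < q ^ m) :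
    ∃ (Pi : Matrix (Fin m) (Fin n) F) (R : (Fin m → F) → (Fin n → F)),
      ∀ w : Fin n → F,
        ({i | w i ≠ 0} : Set (Fin n)).toFinset.card ≤ k →
        R (Pi.mulVec w) = w := by
  subst hq
  obtain ⟨A, hA⟩ := exists_matrix_mulVec_ne_zero hkn hm
  have hinj : Set.InjOn A.mulVec {w : Fin n → F | hammingNorm w ≤ k} := by
    intro v hv w hw hvw
    refine neg_add_eq_zero.mp (hA (-v + w) ?_ ?_)
    · have htri := hammingDist_triangle v 0 w
      rw [hammingDist_zero_right, hammingDist_zero_left, hammingDist_eq_hammingNorm] at htri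
      simp only [Set.mem_ofPred_eq] at hv hw
      rw [two_mul]
      exact htri.trans (add_le_add hv hw)
    · rw [Matrix.mulVec_add, Matrix.mulVec_neg, neg_add_eq_zero]
      exact hvw
  refine ⟨A, Function.invFunOn A.mulVec {w | hammingNorm w ≤ k}, fun w hw => ?_⟩
  refine hinj.leftInvOn_invFunOn (?_ : hammingNorm w ≤ k)
  unfold hammingNorm
  convert hw using 2
  ext i
  simp
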